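/- arXiv:2101.11411 — 2 statements merged into one kernel-verified Lean document; each statement's English description precedes it below -/
import Mathlib

section
/- Let M : ℕ → ℝ be a weight sequence in the class LC, with m_p := M_p/p!, and let ω_M be its associated weight function. Then the following are equivalent: (i) there exist C ≥ 1 and D ≥ 1 such that ω_M(λ·t) ≤ C·λ·ω_M(t) + D·λ for all λ ≥ 1 and all t ≥ 0 (condition (α0)); (ii) there exist B ≥ 1 and a positive integer C such that λ·(M_p)^{1/p} ≤ B·(M_{λ·C·p})^{1/(λ·C·p)} for all positive integers λ and all p ≥ 1; (iii) there exist A ≥ 1 and a positive integer C such that (m_p)^{1/p} ≤ A·(m_q)^{1/q} for all p ≥ 1 and all q ≥ C·p; (iv) the weight matrix M_{ω_M} associated with ω_M satisfies (M_{rai}). -/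
open Filter Real Asymptotics

/-- The associated weight function of a weight sequence `M`. -/
noncomputable def omegaM (M : ℕ → ℝ) (t : ℝ) : ℝ :=
  if t = 0 then 0 else ⨆ p : ℕ, Real.log (t ^ p / M p)

/-- The class `LC`: positive, normalized, log-convex weight sequences whose
`p`-th roots tend to infinity. -/
def IsLC (M : ℕ → ℝ) : Prop :=
  (∀ p, 0 < M p) ∧ M 0 = 1 ∧ M 0 ≤ M 1 ∧
  (∀ p : ℕ, 1 ≤ p → (M p) ^ 2 ≤ M (p - 1) * M (p + 1)) ∧
  Filter.Tendsto (fun p : ℕ => (M p) ^ (1 / (p : ℝ))) Filter.atTop Filter.atTop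

/-- The quotient sequence `μ_0 = 1`, `μ_p = M_p / M_{p-1}`. -/
noncomputable def mu (M : ℕ → ℝ) (p : ℕ) : ℝ :=
  if p = 0 then 1 else M p / M (p - 1)

/-- Moderate growth `(mg)`. -/
def HasMG (M : ℕ → ℝ) : Prop :=
  ∃ C : ℝ, 1 ≤ C ∧ ∀ p q : ℕ, M (p + q) ≤ C ^ (p + q) * M p * M q

/-- `m_p := M_p / p!`. -/
noncomputable def mseq (M : ℕ → ℝ) (p : ℕ) : ℝ := M p / (Nat.factorial p)

/-- Young conjugate of `x ↦ ω_M(eˣ)`. -/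
noncomputable def phiStar (M : ℕ → ℝ) (y : ℝ) : ℝ :=
  sSup ((fun x => x * y - omegaM M (Real.exp x)) '' Set.Ici (0 : ℝ))

/-- The weight matrix associated with `ω_M`: `M^{(l)}_p := exp((1/l)·φ*(l·p))`. -/
noncomputable def MMat (M : ℕ → ℝ) (l : ℝ) (p : ℕ) : ℝ :=
  Real.exp ((1 / l) * phiStar M (l * p))

/-- `m^{(l)}_p := M^{(l)}_p / p!`. -/
noncomputable def mMat (M : ℕ → ℝ) (l : ℝ) (p : ℕ) : ℝ :=
  MMat M l p / (Nat.factorial p)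

/-- The Roumieu root-almost-increasing condition `(M_{rai})` for the weight matrix
associated with `ω_M`. -/
def MRai (M : ℕ → ℝ) : Prop :=
  ∀ x : ℝ, 0 < x → ∃ C : ℝ, 0 < C ∧ ∃ y : ℝ, 0 < y ∧
    ∀ p q : ℕ, 1 ≤ p → p ≤ q →
      (mMat M x p) ^ (1 / (p : ℝ)) ≤ C * (mMat M y q) ^ (1 / (q : ℝ))

/-- `M ≼ N` : `sup_{p ≥ 1} (M_p/N_p)^{1/p} < ∞`. -/
def Precsim (M N : ℕ → ℝ) : Prop :=
  ∃ A : ℝ, ∀ p : ℕ, 1 ≤ p → (M p / N p) ^ (1 / (p : ℝ)) ≤ A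

/-- `M ≈ N` : mutual `≼`. -/
def Approx (M N : ℕ → ℝ) : Prop := Precsim M N ∧ Precsim N M

/-- Condition `(ω1)` for a weight function. -/
def Omega1 (w : ℝ → ℝ) : Prop :=
  ∃ L : ℝ, 1 ≤ L ∧ ∀ t : ℝ, 0 ≤ t → w (2 * t) ≤ L * (w t + 1)

/-- Condition `(α0)` (in the rewritten form valid for all `t ≥ 0`). -/
def Alpha0 (w : ℝ → ℝ) : Prop :=
  ∃ C : ℝ, 1 ≤ C ∧ ∃ D : ℝ, 1 ≤ D ∧ ∀ lam : ℝ, 1 ≤ lam → ∀ t : ℝ, 0 ≤ t →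
    w (lam * t) ≤ C * lam * w t + D * lam

lemma aux_supp (L : ℕ → ℝ) (hd : ∀ p, L (p+1) - L p ≤ L (p+2) - L (p+1)) (p k : ℕ) :
    L p + ((k:ℝ) - p) * (L (p+1) - L p) ≤ L k := by
  have hm : Monotone (fun n => L (n+1) - L n) := monotone_nat_of_le_succ hd
  rcases le_total p k with h | h
  · induction k, h using Nat.le_induction with
    | base => simp
    | succ k hk ih =>
      have := hm hk
      simp only at this
      push_cast
      nlinarith
  · obtain ⟨j, rfl⟩ := Nat.exists_eq_add_of_le h
    clear h
    have key : ∀ j k : ℕ, L (k+j) - L k ≤ j * (L (k+j+1) - L (k+j)) := by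
      intro j k
      induction j with
      | zero => simp
      | succ j ih =>
        have h1 := hm (Nat.le_succ (k+j))
        simp only [Nat.succ_eq_add_one] at h1
        rw [← add_assoc]
        push_cast
        have hj : (0:ℝ) ≤ j := Nat.cast_nonneg j
        nlinarith [mul_le_mul_of_nonneg_left h1 hj]
    have := key j k
    push_cast
    linarith

structure LD (M L : ℕ → ℝ) : Prop where
  pos : ∀ p, 0 < M p
  eqL : ∀ p, L p = Real.log (M p)
  zero : L 0 = 0
  nonneg : ∀ p, 0 ≤ L p
  supp : ∀ p : ℕ, ∃ x : ℝ, 0 ≤ x ∧ ∀ k : ℕ, L p + ((k:ℝ) - p) * x ≤ L k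
  mono : ∀ p q : ℕ, 1 ≤ p → p ≤ q → L p / p ≤ L q / q
  bdd : ∀ x : ℝ, BddAbove (Set.range (fun p : ℕ => (p:ℝ) * x - L p))

lemma LD_of (M : ℕ → ℝ) (hM : IsLC M) : LD M (fun p => Real.log (M p)) := by
  obtain ⟨hpos, h0, h1, hc, ht⟩ := hM
  set L : ℕ → ℝ := fun p => Real.log (M p) with hL
  have hd : ∀ p, L (p+1) - L p ≤ L (p+2) - L (p+1) := by
    intro p
    have h := Real.log_le_log (pow_pos (hpos _) 2) (hc (p+1) (by omega))
    rw [Real.log_pow, Real.log_mul (hpos _).ne' (hpos _).ne'] at h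
    simp only [Nat.add_sub_cancel] at h
    push_cast at h
    simp only [hL]
    have e : p + 1 + 1 = p + 2 := rfl
    rw [e] at h
    linarith
  have hz : L 0 = 0 := by simp [hL, h0]
  have hL1 : 0 ≤ L 1 := Real.log_nonneg (by rw [← h0]; exact h1)
  have hs := aux_supp L hd
  have hnn : ∀ p, 0 ≤ L p := by
    intro p
    have := hs 0 p
    simp [hz] at this
    exact le_trans (by positivity) this
  have hx : ∀ p, L p ≤ p * (L (p+1) - L p) := by
    intro p
    have := hs p 0
    rw [hz] at this
    push_cast at this
    linarith
  have hmd : Monotone (fun n => L (n+1) - L n) := monotone_nat_of_le_succ hd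
  refine ⟨hpos, fun _ => rfl, hz, hnn, ?_, ?_, ?_⟩
  · intro p
    refine ⟨L (p+1) - L p, ?_, hs p⟩
    have := hmd (Nat.zero_le p)
    simp [hz] at this
    linarith
  · intro p q hp hpq
    have hp' : (0:ℝ) < p := by exact_mod_cast hp
    have hq' : (0:ℝ) < q := by exact_mod_cast (lt_of_lt_of_le hp hpq)
    have hpq' : (p:ℝ) ≤ q := by exact_mod_cast hpq
    rw [div_le_div_iff₀ hp' hq']
    have a := hs p q
    have b := hx p
    nlinarith [mul_le_mul_of_nonneg_left b (sub_nonneg.2 hpq')]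
  · intro x
    apply Filter.IsBoundedUnder.bddAbove_range
    refine ⟨0, ?_⟩
    rw [Filter.eventually_map]
    filter_upwards [ht.eventually_ge_atTop (Real.exp x), Filter.eventually_ge_atTop 1] with p hp h1p
    have hp' : (0:ℝ) < p := by exact_mod_cast h1p
    rw [Real.rpow_def_of_pos (hpos p), Real.exp_le_exp, mul_one_div, le_div_iff₀ hp'] at hp
    simp only [hL]
    linarith

noncomputable def WW (M : ℕ → ℝ) (x : ℝ) : ℝ := omegaM M (Real.exp x)

lemma WW_eq {M L : ℕ → ℝ} (h : LD M L) (x : ℝ) : WW M x = ⨆ p : ℕ, ((p:ℝ) * x - L p) := by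
  unfold WW omegaM
  rw [if_neg (Real.exp_pos x).ne']
  congr 1
  ext p
  rw [Real.log_div (by positivity) (h.pos p).ne', Real.log_pow, Real.log_exp, h.eqL]

lemma WW_ge {M L : ℕ → ℝ} (h : LD M L) (x : ℝ) (p : ℕ) : (p:ℝ) * x - L p ≤ WW M x := by
  rw [WW_eq h]
  exact le_ciSup (h.bdd x) p

lemma WW_le {M L : ℕ → ℝ} (h : LD M L) (x b : ℝ) (hb : ∀ p : ℕ, (p:ℝ) * x - L p ≤ b) :
    WW M x ≤ b := by
  rw [WW_eq h]
  exact ciSup_le hb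

lemma WW_nonneg {M L : ℕ → ℝ} (h : LD M L) (x : ℝ) : 0 ≤ WW M x := by
  have := WW_ge h x 0
  simpa [h.zero] using this

lemma WW_supp {M L : ℕ → ℝ} (h : LD M L) (p : ℕ) : ∃ x, 0 ≤ x ∧ WW M x ≤ p * x - L p := by
  obtain ⟨x, hx, hs⟩ := h.supp p
  refine ⟨x, hx, WW_le h _ _ fun k => ?_⟩
  have := hs k
  linarith

lemma phi_bdd {M L : ℕ → ℝ} (h : LD M L) (y : ℝ) :
    BddAbove ((fun x => x * y - omegaM M (Real.exp x)) '' Set.Ici (0 : ℝ)) := by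
  obtain ⟨n, hn⟩ := exists_nat_ge y
  refine ⟨L n, ?_⟩
  rintro _ ⟨x, hx, rfl⟩
  have := WW_ge h x n
  unfold WW at this
  have hx : (0:ℝ) ≤ x := hx
  simp only
  nlinarith [mul_le_mul_of_nonneg_left hn hx]

lemma phi_ge {M L : ℕ → ℝ} (h : LD M L) (y x : ℝ) (hx : 0 ≤ x) : x * y - WW M x ≤ phiStar M y :=
  le_csSup (phi_bdd h y) ⟨x, hx, rfl⟩

lemma phi_le {M : ℕ → ℝ} (y b : ℝ) (hb : ∀ x, 0 ≤ x → x * y - WW M x ≤ b) :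
    phiStar M y ≤ b := by
  apply csSup_le
  · exact ⟨_, 0, Set.self_mem_Ici, rfl⟩
  · rintro _ ⟨x, hx, rfl⟩
    exact hb x hx

lemma phi_nat {M L : ℕ → ℝ} (h : LD M L) (p : ℕ) : phiStar M p = L p := by
  apply le_antisymm
  · apply phi_le
    intro x _
    have := WW_ge h x p
    linarith
  · obtain ⟨x, hx, hs⟩ := WW_supp h p
    have := phi_ge h p x hx
    linarith

lemma phi_mono {M L : ℕ → ℝ} (h : LD M L) (a b : ℝ) (ha : 0 < a) (hab : a ≤ b) :
    phiStar M a / a ≤ phiStar M b / b := by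
  have hb : 0 < b := ha.trans_le hab
  rw [div_le_iff₀ ha]
  apply phi_le
  intro x hx
  have h1 := phi_ge h b x hx
  have h2 := WW_nonneg h x
  rw [div_mul_eq_mul_div, le_div_iff₀ hb]
  nlinarith [mul_le_mul_of_nonneg_left h1 ha.le, mul_le_mul_of_nonneg_left hab h2]

/-- the hub condition -/
def Hub (L : ℕ → ℝ) : Prop := ∃ a : ℝ, 0 ≤ a ∧ ∀ p q : ℕ, 1 ≤ p → p ≤ q →
  L p / p + Real.log q ≤ a + L q / q + Real.log p

lemma hub_of {M L : ℕ → ℝ} (h : LD M L) (a C : ℝ) (hC : 1 ≤ C)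
    (H : ∀ p q : ℕ, 1 ≤ p → C * p ≤ q → L p / p + Real.log q ≤ a + L q / q + Real.log p) :
    Hub L := by
  refine ⟨max a (Real.log C), le_max_of_le_right (Real.log_nonneg hC), fun p q hp hpq => ?_⟩
  have hp' : (0:ℝ) < p := by exact_mod_cast hp
  have hq' : (0:ℝ) < q := by exact_mod_cast (lt_of_lt_of_le hp hpq)
  rcases le_total (C * p) q with hc | hc
  · have := H p q hp hc
    have := le_max_left a (Real.log C)
    linarith
  · have h1 := h.mono p q hp hpq
    have h2 := Real.log_le_log hq' hc
    rw [Real.log_mul (by positivity) hp'.ne'] at h2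
    have := le_max_right a (Real.log C)
    linarith

lemma fact_le (p : ℕ) (hp : 1 ≤ p) : Real.log (p.factorial) / p ≤ Real.log p := by
  have hp' : (0:ℝ) < p := by exact_mod_cast hp
  rw [div_le_iff₀ hp', mul_comm, ← Real.log_pow]
  apply Real.log_le_log (by exact_mod_cast Nat.factorial_pos p)
  exact_mod_cast Nat.factorial_le_pow p

lemma fact_ge (p : ℕ) (hp : 1 ≤ p) : Real.log p - 1 ≤ Real.log (p.factorial) / p := by
  have hp' : (0:ℝ) < p := by exact_mod_cast hp
  have hf : (0:ℝ) < p.factorial := by exact_mod_cast Nat.factorial_pos p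
  rw [le_div_iff₀ hp']
  have h := Real.log_le_log (by positivity) (Real.pow_div_factorial_le_exp (p:ℝ) hp'.le p)
  rw [Real.log_exp, Real.log_div (by positivity) hf.ne', Real.log_pow] at h
  linarith

lemma root_M {M L : ℕ → ℝ} (h : LD M L) (p : ℕ) : (M p) ^ (1 / (p:ℝ)) = Real.exp (L p / p) := by
  rw [Real.rpow_def_of_pos (h.pos p), h.eqL, mul_one_div]

lemma root_m {M L : ℕ → ℝ} (h : LD M L) (p : ℕ) :
    (mseq M p) ^ (1 / (p:ℝ)) = Real.exp (L p / p - Real.log (p.factorial) / p) := by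
  have hf : (0:ℝ) < p.factorial := by exact_mod_cast Nat.factorial_pos p
  unfold mseq
  rw [Real.rpow_def_of_pos (div_pos (h.pos p) hf), Real.log_div (h.pos p).ne' hf.ne', h.eqL,
    mul_one_div, sub_div]

lemma root_mat (M : ℕ → ℝ) (l : ℝ) (p : ℕ) :
    (mMat M l p) ^ (1 / (p:ℝ)) =
      Real.exp (phiStar M (l * p) / (l * p) - Real.log (p.factorial) / p) := by
  have hf : (0:ℝ) < p.factorial := by exact_mod_cast Nat.factorial_pos p
  unfold mMat MMat
  rw [Real.rpow_def_of_pos (by positivity), Real.log_div (Real.exp_pos _).ne' hf.ne', Real.log_exp,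
    mul_one_div, sub_div]
  congr 2
  rw [one_div_mul_eq_div, div_div]

lemma exp_le_mul {A x y : ℝ} (hA : 0 < A) :
    Real.exp x ≤ A * Real.exp y ↔ x ≤ Real.log A + y := by
  conv_lhs => rw [← Real.exp_log hA, ← Real.exp_add, Real.exp_le_exp]

lemma floor_aux (N q : ℕ) (hN : 1 ≤ N) (k : ℕ) (hk : 1 ≤ k) (hq : N * k ≤ q) :
    k ≤ q / N ∧ N * (q / N) ≤ q ∧ q ≤ 2 * N * (q / N) := by
  have h1 : k ≤ q / N := (Nat.le_div_iff_mul_le hN).2 (by rwa [mul_comm])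
  refine ⟨h1, Nat.mul_div_le q N, ?_⟩
  have h2 := Nat.lt_mul_div_succ q hN
  nlinarith

lemma hub_alpha {M L : ℕ → ℝ} (h : LD M L) (H : Hub L) : Alpha0 (omegaM M) := by
  obtain ⟨a, ha, H⟩ := H
  set K : ℝ := Real.exp a + 1 with hK
  have hK1 : 1 ≤ K := by have := Real.exp_pos a; linarith
  refine ⟨2 * K, by linarith, 1 + a * K, by nlinarith, fun lam hlam t ht => ?_⟩
  have hlam0 : 0 < lam := by linarith
  rcases ht.eq_or_lt with rfl | ht
  · rw [mul_zero]
    simp only [omegaM, if_true, mul_zero, zero_add]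
    positivity
  obtain ⟨x, rfl⟩ : ∃ x, Real.exp x = t := ⟨_, Real.exp_log ht⟩
  obtain ⟨s, rfl⟩ : ∃ s, Real.exp s = lam := ⟨_, Real.exp_log hlam0⟩
  rw [← Real.exp_add]
  change WW M (s + x) ≤ 2 * K * Real.exp s * WW M x + (1 + a * K) * Real.exp s
  have hW := WW_nonneg h x
  set E := Real.exp s with hE
  obtain ⟨N, hN1, hN2⟩ : ∃ N : ℕ, Real.exp (s + a) ≤ N ∧ (N:ℝ) ≤ K * E := by
    refine ⟨⌈Real.exp (s+a)⌉₊, Nat.le_ceil _, ?_⟩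
    have := (Nat.ceil_lt_add_one (Real.exp_pos (s+a)).le).le
    rw [Real.exp_add] at this ⊢
    rw [hK]
    nlinarith
  have hNpos : 1 ≤ N := by
    have : (0:ℝ) < N := (Real.exp_pos _).trans_le hN1
    exact_mod_cast this
  have hNr : (0:ℝ) < N := by exact_mod_cast hNpos
  have hlogN : s + a ≤ Real.log N := by
    rwa [Real.le_log_iff_exp_le hNr]
  apply WW_le h
  intro p
  rcases Nat.eq_zero_or_pos p with rfl | hp
  · rw [h.zero]; simp only [Nat.cast_zero, zero_mul, sub_zero]; positivity
  have hp' : (0:ℝ) < p := by exact_mod_cast hp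
  rcases le_or_gt N p with hNp | hNp
  · obtain ⟨h1, h2, h3⟩ := floor_aux N p hNpos 1 le_rfl (by simpa using hNp)
    set q := p / N with hq
    have hq' : (0:ℝ) < q := by exact_mod_cast h1
    have hqp : q ≤ p := Nat.div_le_self _ _
    have e := H q p h1 hqp
    have h2' : (N:ℝ) * q ≤ p := by exact_mod_cast h2
    have h3' : (p:ℝ) ≤ 2 * N * q := by exact_mod_cast h3
    have e2 := Real.log_le_log (by positivity) h2'
    rw [Real.log_mul hNr.ne' hq'.ne'] at e2
    have e3 : L q / q + s ≤ L p / p := by linarith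
    have e4 := WW_ge h x q
    have e5 : (p:ℝ) * (s + x) - L p ≤ (p / q) * (q * x - L q) := by
      have : (p:ℝ) * (L q / q + s) ≤ p * (L p / p) := mul_le_mul_of_nonneg_left e3 hp'.le
      have u : (p:ℝ) * (L p / p) = L p := by field_simp
      have v : (p / q:ℝ) * (q * x - L q) = p * x - p * (L q / q) := by field_simp
      rw [u] at this; rw [v]; linarith
    have e6 : (p:ℝ) / q ≤ 2 * N := by rwa [div_le_iff₀ hq']
    have e7 : (p / q:ℝ) * (q * x - L q) ≤ (p / q) * WW M x :=
      mul_le_mul_of_nonneg_left e4 (by positivity)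
    have e8 : (p / q:ℝ) * WW M x ≤ 2 * (K * E) * WW M x :=
      mul_le_mul_of_nonneg_right (by linarith) hW
    have e9 : 0 ≤ (1 + a * K) * E := by positivity
    linarith
  · have hpN : (p:ℝ) ≤ K * E := le_trans (by exact_mod_cast hNp.le) hN2
    have e := H 1 p le_rfl hp
    simp only [Nat.cast_one, div_one, Real.log_one, add_zero] at e
    have e4 := WW_ge h x 1
    simp only [Nat.cast_one, one_mul] at e4
    have u : (p:ℝ) * (L p / p) = L p := by field_simp
    have e5 : (p:ℝ) * (L 1 + Real.log p) ≤ p * a + L p := by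
      rw [← u, ← mul_add]; exact mul_le_mul_of_nonneg_left e hp'.le
    have e6 : (p:ℝ) * (s - Real.log p) ≤ E := by
      have := Real.add_one_le_exp (s - Real.log p)
      rw [Real.exp_sub, Real.exp_log hp', le_div_iff₀ hp'] at this
      linarith
    have e7 : (p:ℝ) * (x - L 1) ≤ p * WW M x := mul_le_mul_of_nonneg_left e4 hp'.le
    have e8 : (p:ℝ) * WW M x ≤ K * E * WW M x := mul_le_mul_of_nonneg_right hpN hW
    have e9 : (p:ℝ) * a ≤ K * E * a := mul_le_mul_of_nonneg_right hpN ha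
    have e10 : 0 ≤ K * E * WW M x := by positivity
    linarith

lemma alpha_hub {M L : ℕ → ℝ} (h : LD M L) (H : Alpha0 (omegaM M)) : Hub L := by
  obtain ⟨C, hC, D, hD, H⟩ := H
  refine hub_of h (Real.log C + D) C hC fun p q hp hpq => ?_
  have hC0 : 0 < C := by linarith
  have hp' : (0:ℝ) < p := by exact_mod_cast hp
  have hp1 : (1:ℝ) ≤ p := by exact_mod_cast hp
  have hq' : (0:ℝ) < q := lt_of_lt_of_le (by positivity) hpq
  obtain ⟨x, hx, hs⟩ := WW_supp h p
  have h1 := H (q / (C * p)) (by rwa [one_le_div (by positivity)]) (Real.exp x) (Real.exp_pos x).le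
  set s := Real.log (q / (C * p)) with hsd
  have hes : Real.exp s = q / (C * p) := Real.exp_log (by positivity)
  have hsl : s = Real.log q - (Real.log C + Real.log p) := by
    rw [hsd, Real.log_div hq'.ne' (by positivity), Real.log_mul hC0.ne' hp'.ne']
  rw [← hes, ← Real.exp_add, hes] at h1
  change WW M (s + x) ≤ C * (q / (C * p)) * WW M x + D * (q / (C * p)) at h1
  have h2 := WW_ge h (s + x) q
  have e1 : C * (q / (C * p)) = q / p := by field_simp
  rw [e1] at h1
  have h3 : (q / p:ℝ) * WW M x ≤ (q / p) * (p * x - L p) :=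
    mul_le_mul_of_nonneg_left hs (by positivity)
  have e2 : (q / p:ℝ) * (p * x - L p) = q * x - q * (L p / p) := by field_simp
  have h4 : D * (q / (C * p)) ≤ D * q := by
    apply mul_le_mul_of_nonneg_left _ (by linarith)
    apply div_le_self hq'.le
    nlinarith
  have h5 : (q:ℝ) * (L p / p + s - D) ≤ L q := by linarith
  have h6 : L p / p + s - D ≤ L q / q := by
    rw [le_div_iff₀ hq']; linarith
  linarith

lemma ii_hub {M L : ℕ → ℝ} (h : LD M L)
    (H : ∃ B : ℝ, 1 ≤ B ∧ ∃ C : ℕ, 1 ≤ C ∧ ∀ lam p : ℕ, 1 ≤ lam → 1 ≤ p →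
        (lam : ℝ) * (M p) ^ (1 / (p : ℝ)) ≤
          B * (M (lam * C * p)) ^ (1 / ((lam : ℝ) * C * p))) : Hub L := by
  obtain ⟨B, hB, C, hC, H⟩ := H
  have hCr : (1:ℝ) ≤ C := by exact_mod_cast hC
  refine hub_of h (Real.log B + Real.log (2 * C)) C hCr fun p q hp hpq => ?_
  have hp' : (0:ℝ) < p := by exact_mod_cast hp
  have hpq : C * p ≤ q := by exact_mod_cast hpq
  have hCp : 1 ≤ C * p := Nat.mul_pos hC hp
  have hq1 : 1 ≤ q := hCp.trans hpq
  have hq' : (0:ℝ) < q := by exact_mod_cast hq1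
  obtain ⟨h1, h2, h3⟩ := floor_aux (C * p) q hCp 1 le_rfl (by simpa using hpq)
  set l := q / (C * p) with hl
  have hl' : (0:ℝ) < l := by exact_mod_cast h1
  have e := H l p h1 hp
  have ec : (l:ℝ) * C * p = ((l * C * p : ℕ) : ℝ) := by push_cast; ring
  rw [ec, root_M h, root_M h] at e
  have hl2 : (l:ℝ) * Real.exp (L p / p) = Real.exp (Real.log l + L p / p) := by
    rw [Real.exp_add, Real.exp_log hl']
  rw [hl2, exp_le_mul (by linarith)] at e
  have hle : l * C * p ≤ q := by rw [mul_assoc, mul_comm]; exact h2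
  have m := h.mono (l * C * p) q (Nat.mul_pos (Nat.mul_pos h1 hC) hp) hle
  have h3' : (q:ℝ) ≤ (2 * C) * p * l := by
    have : (q:ℝ) ≤ ((2 * (C * p) * l : ℕ):ℝ) := by exact_mod_cast h3
    push_cast at this; linarith
  have lg := Real.log_le_log hq' h3'
  rw [Real.log_mul (by positivity) hl'.ne', Real.log_mul (by positivity) hp'.ne'] at lg
  linarith

lemma hub_ii {M L : ℕ → ℝ} (h : LD M L) (H : Hub L) :
    ∃ B : ℝ, 1 ≤ B ∧ ∃ C : ℕ, 1 ≤ C ∧ ∀ lam p : ℕ, 1 ≤ lam → 1 ≤ p →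
        (lam : ℝ) * (M p) ^ (1 / (p : ℝ)) ≤
          B * (M (lam * C * p)) ^ (1 / ((lam : ℝ) * C * p)) := by
  obtain ⟨a, ha, H⟩ := H
  refine ⟨Real.exp a, Real.one_le_exp ha, 1, le_rfl, fun l p hl hp => ?_⟩
  have hp' : (0:ℝ) < p := by exact_mod_cast hp
  have hl' : (0:ℝ) < l := by exact_mod_cast hl
  have ec : (l:ℝ) * (1:ℕ) * p = ((l * 1 * p : ℕ) : ℝ) := by push_cast; ring
  have hl2 : (l:ℝ) * Real.exp (L p / p) = Real.exp (Real.log l + L p / p) := by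
    rw [Real.exp_add, Real.exp_log hl']
  rw [ec, root_M h, root_M h, hl2, exp_le_mul (Real.exp_pos a), Real.log_exp]
  have := H p (l * 1 * p) hp (by nlinarith)
  rw [← ec, Real.log_mul (by positivity) hp'.ne', ec] at this
  simp only [Nat.cast_one, mul_one] at this ⊢
  linarith

lemma iii_hub {M L : ℕ → ℝ} (h : LD M L)
    (H : ∃ A : ℝ, 1 ≤ A ∧ ∃ C : ℕ, 1 ≤ C ∧ ∀ p q : ℕ, 1 ≤ p → C * p ≤ q →
        (mseq M p) ^ (1 / (p : ℝ)) ≤ A * (mseq M q) ^ (1 / (q : ℝ))) : Hub L := by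
  obtain ⟨A, hA, C, hC, H⟩ := H
  have hCr : (1:ℝ) ≤ C := by exact_mod_cast hC
  refine hub_of h (Real.log A + 1) C hCr fun p q hp hpq => ?_
  have hpq : C * p ≤ q := by exact_mod_cast hpq
  have hq1 : 1 ≤ q := le_trans (Nat.mul_pos hC hp) hpq
  have e := H p q hp hpq
  rw [root_m h, root_m h, exp_le_mul (by linarith)] at e
  have := fact_le p hp
  have := fact_ge q hq1
  linarith

lemma hub_iii {M L : ℕ → ℝ} (h : LD M L) (H : Hub L) :
    ∃ A : ℝ, 1 ≤ A ∧ ∃ C : ℕ, 1 ≤ C ∧ ∀ p q : ℕ, 1 ≤ p → C * p ≤ q →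
        (mseq M p) ^ (1 / (p : ℝ)) ≤ A * (mseq M q) ^ (1 / (q : ℝ)) := by
  obtain ⟨a, ha, H⟩ := H
  refine ⟨Real.exp (a + 1), Real.one_le_exp (by linarith), 1, le_rfl, fun p q hp hpq => ?_⟩
  rw [one_mul] at hpq
  rw [root_m h, root_m h, exp_le_mul (Real.exp_pos _), Real.log_exp]
  have := H p q hp hpq
  have := fact_ge p hp
  have := fact_le q (hp.trans hpq)
  linarith

lemma hub_iv {M L : ℕ → ℝ} (h : LD M L) (H : Hub L) : MRai M := by
  obtain ⟨a, ha, H⟩ := H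
  intro x hx
  obtain ⟨n, hn⟩ := exists_nat_ge x
  have hn' : (0:ℝ) < n := hx.trans_le hn
  have hn1 : 1 ≤ n := by exact_mod_cast hn'
  refine ⟨Real.exp (a + 1), Real.exp_pos _, n, hn', fun p q hp hpq => ?_⟩
  have hp' : (0:ℝ) < p := by exact_mod_cast hp
  have hq' : (0:ℝ) < q := by exact_mod_cast (lt_of_lt_of_le hp hpq)
  rw [root_mat, root_mat, exp_le_mul (Real.exp_pos _), Real.log_exp]
  have m := phi_mono h (x * p) (n * p) (by positivity) (mul_le_mul_of_nonneg_right hn hp'.le)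
  have e := H (n * p) (n * q) (Nat.mul_pos hn1 hp) (Nat.mul_le_mul_left n hpq)
  rw [← phi_nat h, ← phi_nat h] at e
  push_cast at e
  rw [Real.log_mul hn'.ne' hp'.ne', Real.log_mul hn'.ne' hq'.ne'] at e
  have := fact_ge p hp
  have := fact_le q (hp.trans hpq)
  linarith

lemma iv_hub {M L : ℕ → ℝ} (h : LD M L) (H : MRai M) : Hub L := by
  obtain ⟨A, hA, y, hy, H⟩ := H 1 one_pos
  obtain ⟨C, hCy⟩ := exists_nat_ge y
  have hC0 : (0:ℝ) < C := hy.trans_le hCy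
  have hC : 1 ≤ C := by exact_mod_cast hC0
  have hCr : (1:ℝ) ≤ C := by exact_mod_cast hC
  refine hub_of h (Real.log A + 1 + Real.log (2 * C)) C hCr fun p r hp hpr => ?_
  have hpr : C * p ≤ r := by exact_mod_cast hpr
  have hp' : (0:ℝ) < p := by exact_mod_cast hp
  have hr1 : 1 ≤ r := le_trans (Nat.mul_pos hC hp) hpr
  have hr' : (0:ℝ) < r := by exact_mod_cast hr1
  obtain ⟨h1, h2, h3⟩ := floor_aux C r hC p hp hpr
  set q := r / C with hq
  have hq1 : 1 ≤ q := hp.trans h1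
  have hq' : (0:ℝ) < q := by exact_mod_cast hq1
  have e := H p q hp h1
  rw [root_mat, root_mat, exp_le_mul hA, one_mul, phi_nat h] at e
  have m := phi_mono h (y * q) (C * q) (by positivity) (mul_le_mul_of_nonneg_right hCy hq'.le)
  have ec : (C:ℝ) * q = ((C * q : ℕ):ℝ) := by push_cast; ring
  rw [ec, phi_nat h] at m
  have m2 := h.mono (C * q) r (Nat.mul_pos hC hq1) h2
  have h3' : (r:ℝ) ≤ (2 * C) * q := by exact_mod_cast h3
  have lg := Real.log_le_log hr' h3'
  rw [Real.log_mul (by positivity) hq'.ne'] at lg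
  have := fact_le p hp
  have := fact_ge q hq1
  linarith

/-- Theorem 4.5 (main result): characterization of `(α0)` for `ω_M`. -/
theorem stmt14 (M : ℕ → ℝ) (hM : IsLC M) :
    List.TFAE [
      Alpha0 (omegaM M),
      ∃ B : ℝ, 1 ≤ B ∧ ∃ C : ℕ, 1 ≤ C ∧ ∀ lam p : ℕ, 1 ≤ lam → 1 ≤ p →
        (lam : ℝ) * (M p) ^ (1 / (p : ℝ)) ≤
          B * (M (lam * C * p)) ^ (1 / ((lam : ℝ) * C * p)),
      ∃ A : ℝ, 1 ≤ A ∧ ∃ C : ℕ, 1 ≤ C ∧ ∀ p q : ℕ, 1 ≤ p → C * p ≤ q →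
        (mseq M p) ^ (1 / (p : ℝ)) ≤ A * (mseq M q) ^ (1 / (q : ℝ)),
      MRai M] := by
  have h := LD_of M hM
  tfae_have 1 → 2 := fun H => hub_ii h (alpha_hub h H)
  tfae_have 2 → 3 := fun H => hub_iii h (ii_hub h H)
  tfae_have 3 → 4 := fun H => hub_iv h (iii_hub h H)
  tfae_have 4 → 1 := fun H => hub_alpha h (iv_hub h H)
  tfae_finish
end

section
/- Let M : ℕ → ℝ be a weight sequence in the class LC satisfying moderate growth (mg), with quotients μ_p and m_p := M_p/p!. Then the following are equivalent: (i) there exists B ≥ 1 such that λ·(M_p)^{1/p} ≤ B·(M_{λ·p})^{1/(λ·p)} for all positive integers λ, p; (ii) there exists B ≥ 1 such that λ·μ_p ≤ B·μ_{λ·p} for all positive integers λ, p; (iii) M is root almost increasing, i.e. there exists A ≥ 1 with (m_p)^{1/p} ≤ A·(m_q)^{1/q} for all 1 ≤ p ≤ q; (iv) the sequence (μ_p/p)_{p ≥ 1} is almost increasing, i.e. there exists A ≥ 1 with μ_p/p ≤ A·μ_q/q for all 1 ≤ p ≤ q; (v) there exists a weight sequence S in the class LC with M ≈ S such that s_p :=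 S_p/p! is log-convex (M is equivalent to a strongly log-convex sequence); (vi) there exist C ≥ 1 and D ≥ 1 such that ω_M(λ·t) ≤ C·λ·ω_M(t) + D·λ for all λ ≥ 1 and t ≥ 0, i.e. ω_M satisfies (α0) and is equivalent to a subadditive weight function; (vii) the weight matrix M_{ω_M} associated with ω_M satisfies (M_{rai}). -/
open Filter Real Asymptotics

theorem aux_mu_succ (N : ℕ → ℝ) (p : ℕ) : mu N (p+1) = N (p+1) / N p := by
  simp [mu]

theorem aux_mu_pos {N : ℕ → ℝ} (hpos : ∀ p, 0 < N p) (p : ℕ) : 0 < mu N p := by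
  unfold mu; split_ifs
  · exact one_pos
  · exact div_pos (hpos _) (hpos _)

theorem aux_mu_mono {N : ℕ → ℝ} (hpos : ∀ p, 0 < N p)
    (hlc : ∀ p : ℕ, 1 ≤ p → (N p) ^ 2 ≤ N (p - 1) * N (p + 1)) :
    Monotone (fun p => mu N (p+1)) := by
  apply monotone_nat_of_le_succ
  intro p
  simp only [aux_mu_succ]
  have := hlc (p+1) (by omega)
  simp only [Nat.add_sub_cancel] at this
  rw [div_le_div_iff₀ (hpos _) (hpos _)]
  nlinarith

theorem aux_mu_mono' {N : ℕ → ℝ} (hpos : ∀ p, 0 < N p)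
    (hlc : ∀ p : ℕ, 1 ≤ p → (N p) ^ 2 ≤ N (p - 1) * N (p + 1)) {p q : ℕ} (hp : 1 ≤ p)
    (hq : p ≤ q) : mu N p ≤ mu N q := by
  obtain ⟨a, rfl⟩ := Nat.exists_eq_add_of_le' hp
  obtain ⟨b, rfl⟩ := Nat.exists_eq_add_of_le' (hp.trans hq)
  exact aux_mu_mono hpos hlc (by omega)

theorem aux_mul_mu {N : ℕ → ℝ} (hpos : ∀ p, 0 < N p) (p : ℕ) :
    N (p+1) = N p * mu N (p+1) := by
  rw [aux_mu_succ]; field_simp [(hpos p).ne']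

theorem aux_key {N : ℕ → ℝ} (hpos : ∀ p, 0 < N p)
    (hlc : ∀ p : ℕ, 1 ≤ p → (N p) ^ 2 ≤ N (p - 1) * N (p + 1)) (p k : ℕ) (hp : 1 ≤ p) :
    N p * mu N p ^ k ≤ N k * mu N p ^ p := by
  have hm := aux_mu_pos hpos p
  rcases le_total p k with h | h
  · obtain ⟨d, rfl⟩ := Nat.exists_eq_add_of_le h
    have : N p * mu N p ^ d ≤ N (p + d) := by
      clear h
      induction d with
      | zero => simp
      | succ d ih =>
        rw [← add_assoc, aux_mul_mu hpos, pow_succ, ← mul_assoc]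
        exact mul_le_mul ih (aux_mu_mono' hpos hlc hp (by omega)) hm.le (hpos _).le
    calc N p * mu N p ^ (p+d) = (N p * mu N p ^ d) * mu N p ^ p := by ring
      _ ≤ _ := by gcongr
  · have : ∀ d k, k + d = p → N p ≤ N k * mu N p ^ d := by
      intro d
      induction d with
      | zero => intro k hk; simp at hk; simp [hk]
      | succ d ih =>
        intro k hk
        have h1 := ih (k+1) (by omega)
        rw [aux_mul_mu hpos] at h1
        refine h1.trans ?_
        rw [pow_succ', ← mul_assoc]
        have := aux_mu_mono' hpos hlc (p := k+1) (q := p) (by omega) (by omega)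
        have := (hpos k).le
        gcongr
    obtain ⟨d, rfl⟩ := Nat.exists_eq_add_of_le h
    have h1 := this d k rfl
    calc _ ≤ (N k * mu N (k+d) ^ d) * mu N (k+d) ^ k := by gcongr
      _ = _ := by ring

theorem aux_root_mono {N : ℕ → ℝ} (hpos : ∀ p, 0 < N p) (h0 : N 0 = 1)
    (hlc : ∀ p : ℕ, 1 ≤ p → (N p) ^ 2 ≤ N (p - 1) * N (p + 1)) {p q : ℕ} (hp : 1 ≤ p)
    (hq : p ≤ q) : N p ^ (1 / (p:ℝ)) ≤ N q ^ (1 / (q:ℝ)) := by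
  induction q, hq using Nat.le_induction with
  | base => exact le_rfl
  | succ q hq ih =>
    refine ih.trans ?_
    have h1 := aux_key hpos hlc (q+1) 0 (by omega)
    rw [h0, pow_zero, mul_one, one_mul, aux_mu_succ, div_pow, le_div_iff₀ (pow_pos (hpos _) _),
      pow_succ' (N (q+1))] at h1
    have h2 : N q ^ (q+1) ≤ N (q+1) ^ q := le_of_mul_le_mul_left h1 (hpos _)
    have hq0 : (0:ℝ) < q := by exact_mod_cast (by omega : 0 < q)
    have hl := Real.log_le_log (pow_pos (hpos _) _) h2
    rw [Real.log_pow, Real.log_pow] at hl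
    rw [Real.rpow_def_of_pos (hpos _), Real.rpow_def_of_pos (hpos _)]
    apply Real.exp_le_exp.2
    rw [mul_one_div, mul_one_div, div_le_div_iff₀ hq0 (by positivity)]
    push_cast at *
    linarith

theorem aux_fact_le (p : ℕ) (hp : 1 ≤ p) : ((p.factorial : ℝ)) ^ (1 / (p:ℝ)) ≤ p := by
  have h : (p.factorial : ℝ) ≤ (p:ℝ)^p := by exact_mod_cast Nat.factorial_le_pow p
  calc ((p.factorial : ℝ)) ^ (1 / (p:ℝ)) ≤ ((p:ℝ)^p) ^ (1 / (p:ℝ)) := by gcongr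
    _ = p := by rw [one_div]; exact Real.pow_rpow_inv_natCast (by positivity) (by omega)

theorem aux_le_fact (p : ℕ) (hp : 1 ≤ p) :
    (p:ℝ) ≤ Real.exp 1 * ((p.factorial : ℝ)) ^ (1 / (p:ℝ)) := by
  have h := Real.pow_div_factorial_le_exp (p:ℝ) (by positivity) p
  rw [div_le_iff₀ (by positivity)] at h
  have e : Real.exp (p:ℝ) = (Real.exp 1)^p := by rw [← Real.exp_nat_mul]; simp
  calc (p:ℝ) = ((p:ℝ)^p) ^ (1 / (p:ℝ)) := by
        rw [one_div]; exact (Real.pow_rpow_inv_natCast (by positivity) (by omega)).symm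
    _ ≤ (Real.exp 1 ^ p * p.factorial) ^ (1 / (p:ℝ)) := by rw [← e]; gcongr
    _ = _ := by
      rw [Real.mul_rpow (by positivity) (by positivity), one_div,
        Real.pow_rpow_inv_natCast (by positivity) (by omega)]

/-- Central condition: `r_p / p` is almost increasing, where `r_p = M_p^{1/p}`. -/
def AuxR (M : ℕ → ℝ) : Prop :=
  ∃ A : ℝ, 1 ≤ A ∧ ∀ p q : ℕ, 1 ≤ p → p ≤ q →
    M p ^ (1 / (p:ℝ)) * q ≤ A * (M q ^ (1 / (q:ℝ)) * p)

theorem aux_root_pow {N : ℕ → ℝ} (hpos : ∀ p, 0 < N p) (p : ℕ) (hp : 1 ≤ p) :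
    (N p ^ (1 / (p:ℝ))) ^ p = N p := by
  rw [one_div]; exact Real.rpow_inv_natCast_pow (hpos p).le (by omega)

theorem aux_root_le_mu {N : ℕ → ℝ} (hpos : ∀ p, 0 < N p) (h0 : N 0 = 1)
    (hlc : ∀ p : ℕ, 1 ≤ p → (N p) ^ 2 ≤ N (p - 1) * N (p + 1)) (p : ℕ) (hp : 1 ≤ p) :
    N p ^ (1 / (p:ℝ)) ≤ mu N p := by
  have h1 := aux_key hpos hlc p 0 hp
  rw [pow_zero, mul_one, h0, one_mul, ← aux_root_pow hpos p hp] at h1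
  exact le_of_pow_le_pow_left₀ (by omega) (aux_mu_pos hpos p).le h1

theorem aux_mg2 {N : ℕ → ℝ} {C : ℝ} (hpos : ∀ p, 0 < N p)
    (hC : 1 ≤ C) (h : ∀ p q : ℕ, N (p + q) ≤ C ^ (p + q) * N p * N q) (p : ℕ) (hp : 1 ≤ p) :
    N (2 * p) ^ (1 / ((2 * p : ℕ):ℝ)) ≤ C * N p ^ (1 / (p:ℝ)) := by
  have h1 := h p p
  have e := aux_root_pow hpos p hp
  rw [← two_mul, ← aux_root_pow hpos (2*p) (by omega)] at h1
  have hr : 0 < N p ^ (1 / (p:ℝ)) := Real.rpow_pos_of_pos (hpos p) _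
  apply le_of_pow_le_pow_left₀ (n := 2*p) (by omega) (by positivity)
  refine h1.trans (le_of_eq ?_)
  rw [mul_pow]
  nth_rewrite 1 [← e]
  nth_rewrite 2 [← e]
  ring

theorem aux_mu_le_root {N : ℕ → ℝ} {C : ℝ} (hpos : ∀ p, 0 < N p)
    (hlc : ∀ p : ℕ, 1 ≤ p → (N p) ^ 2 ≤ N (p - 1) * N (p + 1)) 
    (hC : 1 ≤ C) (h : ∀ p q : ℕ, N (p + q) ≤ C ^ (p + q) * N p * N q) (p : ℕ) (hp : 1 ≤ p) :
    mu N p ≤ C ^ 2 * N p ^ (1 / (p:ℝ)) := by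
  have hm := aux_mu_pos hpos p
  have h1 := h p p
  have h2 := aux_key hpos hlc p (2*p) hp
  have e := aux_root_pow hpos p hp
  have hr : 0 < N p ^ (1 / (p:ℝ)) := Real.rpow_pos_of_pos (hpos p) _
  rw [← two_mul] at h1
  apply le_of_pow_le_pow_left₀ (n := p) (by omega) (by positivity)
  rw [mul_pow, e]
  have h3 : N p * mu N p ^ (2*p) ≤ (C ^ (2*p) * N p * N p) * mu N p ^ p :=
    h2.trans (by gcongr)
  have h4 : (N p * mu N p ^ p) * mu N p ^ p ≤ (N p * mu N p ^ p) * ((C^2)^p * N p) := by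
    calc _ = N p * mu N p ^ (2*p) := by ring
      _ ≤ _ := h3
      _ = _ := by ring
  exact le_of_mul_le_mul_left h4 (mul_pos (hpos p) (by positivity))

theorem aux_mseq_root {N : ℕ → ℝ} (hpos : ∀ p, 0 < N p) (p : ℕ) :
    mseq N p ^ (1 / (p:ℝ)) = N p ^ (1 / (p:ℝ)) / (p.factorial : ℝ) ^ (1 / (p:ℝ)) := by
  unfold mseq; rw [Real.div_rpow (hpos p).le (by positivity)]

theorem aux_iii_of_R {M : ℕ → ℝ} (hpos : ∀ p, 0 < M p) (h : AuxR M) :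
    ∃ A : ℝ, 1 ≤ A ∧ ∀ p q : ℕ, 1 ≤ p → p ≤ q →
        (mseq M p) ^ (1 / (p : ℝ)) ≤ A * (mseq M q) ^ (1 / (q : ℝ)) := by
  obtain ⟨A, hA, h⟩ := h
  refine ⟨A * Real.exp 1, one_le_mul_of_one_le_of_one_le hA (Real.one_le_exp zero_le_one), ?_⟩
  intro p q hp hq
  rw [aux_mseq_root hpos, aux_mseq_root hpos]
  have h1 := h p q hp hq
  have fp := aux_le_fact p hp
  have fq := aux_fact_le q (hp.trans hq)
  have rp : 0 < M p ^ (1 / (p:ℝ)) := Real.rpow_pos_of_pos (hpos p) _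
  have rq : 0 < M q ^ (1 / (q:ℝ)) := Real.rpow_pos_of_pos (hpos q) _
  rw [mul_div_assoc', div_le_div_iff₀ (by positivity) (by positivity)]
  calc _ ≤ M p ^ (1 / (p:ℝ)) * q := by gcongr
    _ ≤ _ := h1
    _ ≤ A * (M q ^ (1 / (q:ℝ)) * (Real.exp 1 * ((p.factorial : ℝ)) ^ (1 / (p:ℝ)))) := by gcongr
    _ = _ := by ring

theorem aux_R_of_iii {M : ℕ → ℝ} (hpos : ∀ p, 0 < M p) 
    (h : ∃ A : ℝ, 1 ≤ A ∧ ∀ p q : ℕ, 1 ≤ p → p ≤ q →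
        (mseq M p) ^ (1 / (p : ℝ)) ≤ A * (mseq M q) ^ (1 / (q : ℝ))) : AuxR M := by
  obtain ⟨A, hA, h⟩ := h
  refine ⟨A * Real.exp 1, one_le_mul_of_one_le_of_one_le hA (Real.one_le_exp zero_le_one), ?_⟩
  intro p q hp hq
  have h1 := h p q hp hq
  rw [aux_mseq_root hpos, aux_mseq_root hpos] at h1
  have fq := aux_le_fact q (hp.trans hq)
  have fp := aux_fact_le p hp
  have rp : 0 < M p ^ (1 / (p:ℝ)) := Real.rpow_pos_of_pos (hpos p) _
  have rq : 0 < M q ^ (1 / (q:ℝ)) := Real.rpow_pos_of_pos (hpos q) _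
  rw [mul_div_assoc', div_le_div_iff₀ (by positivity) (by positivity)] at h1
  calc _ ≤ M p ^ (1 / (p:ℝ)) * (Real.exp 1 * ((q.factorial : ℝ)) ^ (1 / (q:ℝ))) := by gcongr
    _ = Real.exp 1 * (M p ^ (1 / (p:ℝ)) * ((q.factorial : ℝ)) ^ (1 / (q:ℝ))) := by ring
    _ ≤ _ := mul_le_mul_of_nonneg_left h1 (by positivity)
    _ ≤ Real.exp 1 * (A * M q ^ (1 / (q:ℝ)) * p) := by gcongr
    _ = _ := by ring

/-- A dilation estimate for a monotone positive sequence gives the almost increasing property. -/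
theorem aux_dil {f : ℕ → ℝ} (hf : ∀ p, 0 < f p) (hm : ∀ p q, 1 ≤ p → p ≤ q → f p ≤ f q)
    {B : ℝ} (hB : 1 ≤ B) (h : ∀ lam p : ℕ, 1 ≤ lam → 1 ≤ p → (lam : ℝ) * f p ≤ B * f (lam * p))
    (p q : ℕ) (hp : 1 ≤ p) (hq : p ≤ q) : f p * q ≤ (2 * B) * (f q * p) := by
  have h1 : 1 ≤ q / p := (Nat.one_le_div_iff (by omega)).2 hq
  have h2 := h (q/p) p h1 hp
  have h3 := hm (q / p * p) q (Nat.mul_pos h1 hp) (Nat.div_mul_le_self q p)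
  have h4 : q ≤ 2 * (q / p) * p := by
    have := Nat.div_add_mod q p
    have := Nat.mod_lt q hp
    nlinarith
  have h4' : (q:ℝ) ≤ 2 * ((q/p : ℕ):ℝ) * p := by exact_mod_cast h4
  calc f p * q ≤ f p * (2 * ((q/p : ℕ):ℝ) * p) := by have := (hf p).le; gcongr
    _ = 2 * p * (((q/p : ℕ):ℝ) * f p) := by ring
    _ ≤ 2 * p * (B * f (q / p * p)) := by gcongr
    _ ≤ 2 * p * (B * f q) := by gcongr
    _ = _ := by ring

theorem aux_R_of_i {M : ℕ → ℝ} (hM : IsLC M) (h : ∃ B : ℝ, 1 ≤ B ∧ ∀ lam p : ℕ, 1 ≤ lam → 1 ≤ p →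
        (lam : ℝ) * (M p) ^ (1 / (p : ℝ)) ≤
          B * (M (lam * p)) ^ (1 / ((lam : ℝ) * p))) : AuxR M := by
  obtain ⟨hpos, h0, h01, hlc, -⟩ := hM
  obtain ⟨B, hB, h⟩ := h
  refine ⟨2 * B, by linarith, ?_⟩
  apply aux_dil (f := fun p => M p ^ (1 / (p:ℝ))) (fun p => Real.rpow_pos_of_pos (hpos p) _)
    (fun p q hp hq => aux_root_mono hpos h0 hlc hp hq) hB
  intro lam p hl hp
  simpa using h lam p hl hp

theorem aux_i_of_R {M : ℕ → ℝ} (h : AuxR M) : ∃ B : ℝ, 1 ≤ B ∧ ∀ lam p : ℕ, 1 ≤ lam → 1 ≤ p →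
        (lam : ℝ) * (M p) ^ (1 / (p : ℝ)) ≤
          B * (M (lam * p)) ^ (1 / ((lam : ℝ) * p)) := by
  obtain ⟨B, hB, h⟩ := h
  refine ⟨B, hB, ?_⟩
  intro lam p hl hp
  have h1 := h p (lam * p) hp (Nat.le_mul_of_pos_left p hl)
  have hp' : (0:ℝ) < p := by exact_mod_cast hp
  push_cast at h1
  apply le_of_mul_le_mul_right _ hp'
  linarith

theorem aux_iv_of_ii {M : ℕ → ℝ} (hM : IsLC M) (h : ∃ B : ℝ, 1 ≤ B ∧ ∀ lam p : ℕ, 1 ≤ lam → 1 ≤ p →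
        (lam : ℝ) * mu M p ≤ B * mu M (lam * p)) : 
      ∃ A : ℝ, 1 ≤ A ∧ ∀ p q : ℕ, 1 ≤ p → p ≤ q →
        mu M p / p ≤ A * (mu M q / q) := by
  obtain ⟨hpos, h0, h01, hlc, -⟩ := hM
  obtain ⟨B, hB, h⟩ := h
  refine ⟨2 * B, by linarith, ?_⟩
  intro p q hp hq
  have := aux_dil (f := mu M) (aux_mu_pos hpos)
    (fun p q hp hq => aux_mu_mono' hpos hlc hp hq) hB h p q hp hq
  have hp' : (0:ℝ) < p := by exact_mod_cast hp
  have hq' : (0:ℝ) < q := by exact_mod_cast hp.trans hq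
  rw [mul_div_assoc', div_le_div_iff₀ hp' hq']
  linarith

theorem aux_ii_of_iv {M : ℕ → ℝ} (h : ∃ A : ℝ, 1 ≤ A ∧ ∀ p q : ℕ, 1 ≤ p → p ≤ q →
        mu M p / p ≤ A * (mu M q / q)) : ∃ B : ℝ, 1 ≤ B ∧ ∀ lam p : ℕ, 1 ≤ lam → 1 ≤ p →
        (lam : ℝ) * mu M p ≤ B * mu M (lam * p) := by
  obtain ⟨B, hB, h⟩ := h
  refine ⟨B, hB, ?_⟩
  intro lam p hl hp
  have h1 := h p (lam * p) hp (Nat.le_mul_of_pos_left p hl)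
  have hp' : (0:ℝ) < p := by exact_mod_cast hp
  have hl' : (0:ℝ) < lam := by exact_mod_cast hl
  push_cast at h1
  rw [mul_div_assoc', div_le_div_iff₀ hp' (by positivity)] at h1
  apply le_of_mul_le_mul_right _ hp'
  linarith

theorem aux_iv_of_R {M : ℕ → ℝ} (hM : IsLC M) (hmg : HasMG M) (h : AuxR M) :
    ∃ A : ℝ, 1 ≤ A ∧ ∀ p q : ℕ, 1 ≤ p → p ≤ q →
        mu M p / p ≤ A * (mu M q / q) := by
  obtain ⟨hpos, h0, h01, hlc, -⟩ := hM
  obtain ⟨A, hA, h⟩ := h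
  obtain ⟨C, hC, hmg⟩ := hmg
  refine ⟨C ^ 2 * A, one_le_mul_of_one_le_of_one_le (one_le_pow₀ hC) hA, ?_⟩
  intro p q hp hq
  have hp' : (0:ℝ) < p := by exact_mod_cast hp
  have hq' : (0:ℝ) < q := by exact_mod_cast hp.trans hq
  rw [mul_div_assoc', div_le_div_iff₀ hp' hq']
  calc mu M p * q ≤ (C ^ 2 * M p ^ (1 / (p:ℝ))) * q := by
        have := aux_mu_le_root hpos hlc hC hmg p hp
        gcongr
    _ = C ^ 2 * (M p ^ (1 / (p:ℝ)) * q) := by ring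
    _ ≤ C ^ 2 * (A * (M q ^ (1 / (q:ℝ)) * p)) := 
        mul_le_mul_of_nonneg_left (h p q hp hq) (by positivity)
    _ ≤ C ^ 2 * (A * (mu M q * p)) := by
        have := aux_root_le_mu hpos h0 hlc q (hp.trans hq)
        gcongr
    _ = _ := by ring

theorem aux_R_of_v {M : ℕ → ℝ} (hM : IsLC M) (h : ∃ S : ℕ → ℝ, IsLC S ∧ Approx M S ∧
        (∀ p : ℕ, 1 ≤ p → (mseq S p) ^ 2 ≤ mseq S (p - 1) * mseq S (p + 1))) : AuxR M := by
  obtain ⟨S, hS, ⟨⟨A, hA⟩, ⟨B, hB⟩⟩, hlc⟩ := h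
  have hpos := hM.1
  have hSpos := hS.1
  have hspos : ∀ p, 0 < mseq S p := fun p => div_pos (hSpos p) (by positivity)
  apply aux_R_of_iii hpos
  have hA0 : 0 < A := lt_of_lt_of_le (Real.rpow_pos_of_pos (div_pos (hpos 1) (hSpos 1)) _) (hA 1 le_rfl)
  have hB0 : 0 < B := lt_of_lt_of_le (Real.rpow_pos_of_pos (div_pos (hSpos 1) (hpos 1)) _) (hB 1 le_rfl)
  refine ⟨max 1 (A * B), le_max_left _ _, ?_⟩
  intro p q hp hq
  have h1 := aux_root_mono hspos (by simp [mseq, hS.2.1]) hlc hp hq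
  have ep : mseq M p = (M p / S p) * mseq S p := by
    unfold mseq; field_simp [(hSpos p).ne']
  have eq : mseq S q = (S q / M q) * mseq M q := by
    unfold mseq; field_simp [(hpos q).ne']
  have hmq : 0 < mseq M q := div_pos (hpos q) (by positivity)
  calc mseq M p ^ (1 / (p:ℝ)) = (M p / S p) ^ (1 / (p:ℝ)) * mseq S p ^ (1 / (p:ℝ)) := by
        rw [ep, Real.mul_rpow (div_pos (hpos _) (hSpos _)).le (hspos p).le]
    _ ≤ A * mseq S q ^ (1 / (q:ℝ)) := 
        mul_le_mul (hA p hp) h1 (Real.rpow_nonneg (hspos p).le _) hA0.le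
    _ = A * ((S q / M q) ^ (1 / (q:ℝ)) * mseq M q ^ (1 / (q:ℝ))) := by
        rw [eq, Real.mul_rpow (div_pos (hSpos _) (hpos _)).le hmq.le]
    _ ≤ A * (B * mseq M q ^ (1 / (q:ℝ))) := by
        have := hB q (hp.trans hq)
        have := Real.rpow_nonneg hmq.le (1 / (q:ℝ))
        gcongr
    _ = (A * B) * mseq M q ^ (1 / (q:ℝ)) := by ring
    _ ≤ _ := mul_le_mul_of_nonneg_right (le_max_right _ _) (Real.rpow_nonneg hmq.le _)

theorem aux_prod_mu {M : ℕ → ℝ} (hpos : ∀ p, 0 < M p) (h0 : M 0 = 1) (p : ℕ) :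
    M p = ∏ i ∈ Finset.range p, mu M (i+1) := by
  induction p with
  | zero => simpa using h0
  | succ p ih => rw [Finset.prod_range_succ, ← ih]; exact aux_mul_mu hpos p

theorem aux_v_of_iv {M : ℕ → ℝ} (hM : IsLC M) (h : ∃ A : ℝ, 1 ≤ A ∧ ∀ p q : ℕ, 1 ≤ p → p ≤ q →
        mu M p / p ≤ A * (mu M q / q)) : ∃ S : ℕ → ℝ, IsLC S ∧ Approx M S ∧
        (∀ p : ℕ, 1 ≤ p → (mseq S p) ^ 2 ≤ mseq S (p - 1) * mseq S (p + 1)) := by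
  obtain ⟨hpos, h0, h01, hlc, hlim⟩ := hM
  obtain ⟨A, hA, h⟩ := h
  set f : ℕ → ℝ := fun i => mu M (i+1) / ((i:ℝ)+1) with hf
  set ν : ℕ → ℝ := fun i => partialSups f i with hν
  have hfpos : ∀ i, 0 < f i := fun i => div_pos (aux_mu_pos hpos _) (by positivity)
  have hνge : ∀ i, f i ≤ ν i := fun i => le_partialSups f i
  have hνpos : ∀ i, 0 < ν i := fun i => (hfpos i).trans_le (hνge i)
  have hνmono : Monotone ν := (partialSups f).monotone
  have hνle : ∀ i, ν i ≤ A * f i := by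
    intro i
    apply partialSups_le
    intro j hj
    have := h (j+1) (i+1) (by omega) (by omega)
    push_cast at this
    exact this
  set S : ℕ → ℝ := fun p => ∏ i ∈ Finset.range p, (((i:ℝ)+1) * ν i) with hS
  have hSs : ∀ p, S (p+1) = S p * (((p:ℝ)+1) * ν p) := fun p => Finset.prod_range_succ _ _
  have hSpos : ∀ p, 0 < S p := fun p => Finset.prod_pos (fun i _ => mul_pos (by positivity) (hνpos i))
  have hfe : ∀ i : ℕ, ((i:ℝ)+1) * f i = mu M (i+1) := by
    intro i; simp only [hf]; field_simp
  have hMS : ∀ p, M p ≤ S p := by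
    intro p
    rw [aux_prod_mu hpos h0 p]
    apply Finset.prod_le_prod (fun i _ => (aux_mu_pos hpos _).le)
    intro i _
    rw [← hfe]
    have := hνge i
    gcongr
  have hSM : ∀ p, S p ≤ A ^ p * M p := by
    intro p
    rw [aux_prod_mu hpos h0 p]
    calc S p ≤ ∏ i ∈ Finset.range p, (A * mu M (i+1)) := by
          apply Finset.prod_le_prod (fun i _ => (mul_pos (by positivity) (hνpos i)).le)
          intro i _
          rw [← hfe]
          calc ((i:ℝ)+1) * ν i ≤ ((i:ℝ)+1) * (A * f i) := by have := hνle i; gcongr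
            _ = _ := by ring
      _ = _ := by rw [Finset.prod_mul_distrib]; simp
  have hS0 : S 0 = 1 := by simp [hS]
  refine ⟨S, ⟨hSpos, hS0, ?_, ?_, ?_⟩, ⟨⟨1, ?_⟩, ⟨A, ?_⟩⟩, ?_⟩
  · rw [hS0, ← h0]; exact h01.trans (hMS 1)
  · intro p hp
    obtain ⟨p, rfl⟩ := Nat.exists_eq_add_of_le' hp
    simp only [Nat.add_sub_cancel]
    rw [hSs (p+1), hSs p]
    have h1 := hνmono (Nat.le_succ p)
    have h2 : ((p:ℝ)+1) * ν p ≤ (((p+1 : ℕ):ℝ)+1) * ν (p+1) := by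
      have := (hνpos p).le
      push_cast
      apply mul_le_mul (by linarith) h1 this (by positivity)
    have h3 : 0 ≤ S p * (S p * (((p:ℝ)+1) * ν p)) := by
      have := hνpos p; have := hSpos p; positivity
    nlinarith [mul_le_mul_of_nonneg_left h2 h3]
  · apply tendsto_atTop_mono _ hlim
    intro p
    have := (hpos p).le
    have := hMS p
    gcongr
  · intro p hp
    apply Real.rpow_le_one (div_pos (hpos p) (hSpos p)).le _ (by positivity)
    exact (div_le_one (hSpos p)).2 (hMS p)
  · intro p hp
    calc (S p / M p) ^ (1 / (p:ℝ)) ≤ (A ^ p) ^ (1 / (p:ℝ)) := by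
          apply Real.rpow_le_rpow (div_pos (hSpos p) (hpos p)).le _ (by positivity)
          exact (div_le_iff₀ (hpos p)).2 (hSM p)
      _ = A := by rw [one_div]; exact Real.pow_rpow_inv_natCast (by positivity) (by omega)
  · have hs : ∀ p, mseq S (p+1) = mseq S p * ν p := by
      intro p
      simp only [mseq]
      rw [hSs, Nat.factorial_succ]
      push_cast
      field_simp
    intro p hp
    obtain ⟨p, rfl⟩ := Nat.exists_eq_add_of_le' hp
    simp only [Nat.add_sub_cancel]
    rw [hs (p+1), hs p]
    have h1 := hνmono (Nat.le_succ p)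
    have h3 : 0 ≤ mseq S p * (mseq S p * ν p) := by
      have := hνpos p; have : 0 < mseq S p := div_pos (hSpos p) (by positivity)
      positivity
    nlinarith [mul_le_mul_of_nonneg_left h1 h3]

theorem aux_om_bdd {M : ℕ → ℝ} (hM : IsLC M) {t : ℝ} (ht : 0 < t) :
    BddAbove (Set.range fun p : ℕ => Real.log (t ^ p / M p)) := by
  obtain ⟨hpos, h0, h01, hlc, hlim⟩ := hM
  apply Filter.IsBoundedUnder.bddAbove_range
  refine ⟨0, ?_⟩
  rw [Filter.eventually_map]
  filter_upwards [hlim.eventually_ge_atTop t, Filter.eventually_ge_atTop 1] with p h1 hp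
  apply Real.log_nonpos (div_pos (pow_pos ht _) (hpos p)).le
  rw [div_le_one (hpos p), ← aux_root_pow hpos p hp]
  gcongr

theorem aux_om_ge {M : ℕ → ℝ} (hM : IsLC M) {t : ℝ} (ht : 0 < t) (p : ℕ) :
    p * Real.log t - Real.log (M p) ≤ omegaM M t := by
  rw [← Real.log_pow, ← Real.log_div (pow_pos ht _).ne' (hM.1 p).ne']
  unfold omegaM
  rw [if_neg ht.ne']
  exact le_ciSup (aux_om_bdd hM ht) p

theorem aux_om_le {M : ℕ → ℝ} (hM : IsLC M) {t : ℝ} (ht : 0 < t) {K : ℝ}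
    (h : ∀ p : ℕ, p * Real.log t - Real.log (M p) ≤ K) : omegaM M t ≤ K := by
  unfold omegaM
  rw [if_neg ht.ne']
  apply ciSup_le
  intro p
  rw [Real.log_div (pow_pos ht _).ne' (hM.1 p).ne', Real.log_pow]
  exact h p

theorem aux_om_nonneg {M : ℕ → ℝ} (hM : IsLC M) {t : ℝ} (ht : 0 < t) : 0 ≤ omegaM M t := by
  have := aux_om_ge hM ht 0
  simpa [hM.2.1] using this

theorem aux_mu_ge_one {M : ℕ → ℝ} (hM : IsLC M) (p : ℕ) (hp : 1 ≤ p) : 1 ≤ mu M p := by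
  obtain ⟨hpos, h0, h01, hlc, hlim⟩ := hM
  refine le_trans ?_ (aux_mu_mono' hpos hlc le_rfl hp)
  have := aux_mu_succ M 0
  simp only [zero_add] at this
  rw [this, h0, div_one, ← h0]
  exact h01

theorem aux_om_mu {M : ℕ → ℝ} (hM : IsLC M) (p : ℕ) (hp : 1 ≤ p) :
    omegaM M (mu M p) ≤ p * Real.log (mu M p) - Real.log (M p) := by
  have hm := aux_mu_pos hM.1 p
  apply aux_om_le hM hm
  intro k
  have h := Real.log_le_log (mul_pos (hM.1 p) (pow_pos hm _)) (aux_key hM.1 hM.2.2.2.1 p k hp)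
  rw [Real.log_mul (hM.1 _).ne' (pow_pos hm _).ne', Real.log_mul (hM.1 _).ne' (pow_pos hm _).ne',
    Real.log_pow, Real.log_pow] at h
  linarith

theorem aux_log_root {M : ℕ → ℝ} (hpos : ∀ p, 0 < M p) (p : ℕ) (hp : 1 ≤ p) :
    Real.log (M p) = p * Real.log (M p ^ (1 / (p:ℝ))) := by
  rw [← Real.log_pow, aux_root_pow hpos p hp]

theorem aux_i_of_vi {M : ℕ → ℝ} (hM : IsLC M) (hmg : HasMG M) (h : Alpha0 (omegaM M)) :
    ∃ B : ℝ, 1 ≤ B ∧ ∀ lam p : ℕ, 1 ≤ lam → 1 ≤ p →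
        (lam : ℝ) * (M p) ^ (1 / (p : ℝ)) ≤
          B * (M (lam * p)) ^ (1 / ((lam : ℝ) * p)) := by
  obtain ⟨C, hC, D, hD, h⟩ := h
  obtain ⟨K, hK, hmg⟩ := hmg
  have hpos := hM.1
  have hlK : 0 ≤ Real.log (K ^ 2) := Real.log_nonneg (one_le_pow₀ hK)
  refine ⟨Real.exp (C * Real.log (K ^ 2) + D), Real.one_le_exp (by positivity), ?_⟩
  intro lam p hl hp
  have hm := aux_mu_pos hpos p
  have hl' : (1:ℝ) ≤ lam := by exact_mod_cast hl
  have hp' : (1:ℝ) ≤ p := by exact_mod_cast hp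
  have rp : 0 < M p ^ (1 / (p:ℝ)) := Real.rpow_pos_of_pos (hpos p) _
  have rq : 0 < M (lam * p) ^ (1 / ((lam * p : ℕ):ℝ)) := Real.rpow_pos_of_pos (hpos _) _
  have h1 := aux_om_ge hM (t := lam * mu M p) (by positivity) (lam * p)
  have h2 := h lam hl' (mu M p) hm.le
  have h3 := aux_om_mu hM p hp
  have h4 := Real.log_le_log hm (aux_mu_le_root hpos hM.2.2.2.1 hK hmg p hp)
  have h5 := Real.log_le_log rp (aux_root_le_mu hpos hM.2.1 hM.2.2.2.1 p hp)
  rw [Real.log_mul (by positivity) rp.ne'] at h4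
  rw [Real.log_mul (by positivity) hm.ne', aux_log_root hpos (lam * p) (Nat.mul_pos hl hp)] at h1
  rw [aux_log_root hpos p hp] at h3
  have h6 : omegaM M (mu M p) ≤ p * Real.log (K ^ 2) := by nlinarith
  have e : M (lam * p) ^ (1 / ((lam:ℝ) * p)) = M (lam * p) ^ (1 / ((lam * p : ℕ):ℝ)) := by
    push_cast; rfl
  rw [e]
  rw [← Real.log_le_log_iff (by positivity) (by positivity), Real.log_mul (by positivity) rp.ne',
    Real.log_mul (Real.exp_pos _).ne' rq.ne', Real.log_exp]
  set R := Real.log (M (lam * p) ^ (1 / ((lam * p : ℕ):ℝ)))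
  push_cast at h1
  have h7 : (lam:ℝ) * p * (Real.log lam + Real.log (mu M p) - R) ≤
      (lam:ℝ) * p * (C * Real.log (K ^ 2) + D) := by
    calc _ ≤ C * lam * omegaM M (mu M p) + D * lam := by linarith
      _ ≤ C * lam * (p * Real.log (K ^ 2)) + D * lam * p := by
        have : D * lam ≤ D * lam * p := le_mul_of_one_le_right (by positivity) hp'
        gcongr
      _ = _ := by ring
  have := le_of_mul_le_mul_left h7 (by positivity)
  linarith

theorem aux_vi_of_R {M : ℕ → ℝ} (hM : IsLC M) (h : AuxR M) : Alpha0 (omegaM M) := by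
  obtain ⟨A, hA, h⟩ := h
  have hpos := hM.1
  refine ⟨2 * A, by linarith, A, hA, ?_⟩
  intro lam hl t ht
  rcases ht.eq_or_lt with rfl | ht
  · simp [omegaM]; positivity
  apply aux_om_le hM (by positivity)
  intro p
  have hω := aux_om_nonneg hM ht
  rcases Nat.eq_zero_or_pos p with rfl | hp
  · simp [hM.2.1]; positivity
  have hp' : (0:ℝ) < p := by exact_mod_cast hp
  set L : ℝ := 2 * A * lam with hL
  have hL2 : 1 ≤ L := by nlinarith
  set q : ℕ := ⌈(p:ℝ) / L⌉₊ with hqd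
  have hq1 : 1 ≤ q := Nat.one_le_iff_ne_zero.2 (by
    rw [hqd]; exact (Nat.ceil_pos.2 (by positivity)).ne')
  have hqp : q ≤ p := by
    apply Nat.ceil_le.2
    exact div_le_self hp'.le hL2
  have hpq : (p:ℝ) ≤ L * q := by
    have := Nat.le_ceil ((p:ℝ)/L)
    rw [div_le_iff₀ (by positivity)] at this
    rw [mul_comm]; exact this
  have hq' : (1:ℝ) ≤ q := by exact_mod_cast hq1
  have rp : 0 < M p ^ (1 / (p:ℝ)) := Real.rpow_pos_of_pos (hpos p) _
  have rq : 0 < M q ^ (1 / (q:ℝ)) := Real.rpow_pos_of_pos (hpos q) _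
  have h1 := h q p hq1 hqp
  have h2 := Real.log_le_log (by positivity) h1
  have hA0 : A ≠ 0 := by positivity
  have hl0 : lam ≠ 0 := by positivity
  have hq0 : (q:ℝ) ≠ 0 := by positivity
  rw [Real.log_mul rq.ne' hp'.ne', Real.log_mul hA0 (by positivity), Real.log_mul rp.ne' hq0] at h2
  rw [aux_log_root hpos p hp, Real.log_mul hl0 ht.ne']
  have h3 := aux_om_ge hM ht q
  rw [aux_log_root hpos q hq1] at h3
  set a := Real.log (M p ^ (1 / (p:ℝ)))
  set b := Real.log (M q ^ (1 / (q:ℝ)))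
  -- main term
  have h4 : (p:ℝ) * (Real.log t - b) ≤ L * omegaM M t := by
    rcases le_total 0 (Real.log t - b) with hb | hb
    · calc (p:ℝ) * (Real.log t - b) ≤ L * q * (Real.log t - b) := by gcongr
        _ = L * (q * Real.log t - q * b) := by ring
        _ ≤ _ := by gcongr
    · calc (p:ℝ) * (Real.log t - b) ≤ 0 := mul_nonpos_of_nonneg_of_nonpos hp'.le hb
        _ ≤ _ := by positivity
  have h5 : (p:ℝ) * (Real.log lam + Real.log A + Real.log q - Real.log p) ≤ A * lam := by
    have e : Real.log lam + Real.log A + Real.log q - Real.log p = Real.log (lam * A * q / p) := by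
      rw [Real.log_div (by positivity) hp'.ne', Real.log_mul (by positivity) hq0,
        Real.log_mul hl0 hA0]
    rw [e]
    rcases Nat.lt_or_ge q 2 with hq2 | hq2
    · have hqe : q = 1 := by omega
      rw [hqe]
      have := Real.log_le_sub_one_of_pos (x := lam * A * ((1:ℕ):ℝ) / p) (by positivity)
      calc _ ≤ (p:ℝ) * (lam * A * ((1:ℕ):ℝ) / p) := by
            apply mul_le_mul_of_nonneg_left _ hp'.le; linarith
        _ = _ := by push_cast; field_simp
    · have hq2' : (2:ℝ) ≤ q := by exact_mod_cast hq2
      have h6 : (q:ℝ) < p / L + 1 := Nat.ceil_lt_add_one (by positivity)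
      have h7 : lam * A * q ≤ p := by
        have h8 : (q:ℝ) / 2 ≤ p / L := by linarith
        rw [le_div_iff₀ (by positivity)] at h8
        rw [hL] at h8
        linarith
      have : Real.log (lam * A * q / p) ≤ 0 :=
        Real.log_nonpos (by positivity) ((div_le_one hp').2 h7)
      calc _ ≤ (0:ℝ) := mul_nonpos_of_nonneg_of_nonpos hp'.le this
        _ ≤ _ := by positivity
  have h6 : (p:ℝ) * (b + Real.log p) ≤ p * (Real.log A + (a + Real.log q)) := by gcongr
  linarith

theorem aux_phi_bdd {M : ℕ → ℝ} (hM : IsLC M) (n : ℕ) {y : ℝ} (hy : y ≤ n) (x : ℝ) (hx : 0 ≤ x) :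
    x * y - omegaM M (Real.exp x) ≤ Real.log (M n) := by
  have := aux_om_ge hM (Real.exp_pos x) n
  rw [Real.log_exp] at this
  nlinarith

theorem aux_phi_bddAbove {M : ℕ → ℝ} (hM : IsLC M) (y : ℝ) :
    BddAbove ((fun x => x * y - omegaM M (Real.exp x)) '' Set.Ici (0 : ℝ)) := by
  obtain ⟨n, hn⟩ := exists_nat_ge y
  refine ⟨Real.log (M n), ?_⟩
  rintro _ ⟨x, hx, rfl⟩
  exact aux_phi_bdd hM n hn x hx

theorem aux_phi_nat {M : ℕ → ℝ} (hM : IsLC M) (n : ℕ) (hn : 1 ≤ n) :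
    phiStar M n = Real.log (M n) := by
  apply le_antisymm
  · apply csSup_le (Set.Nonempty.image _ Set.nonempty_Ici)
    rintro _ ⟨x, hx, rfl⟩
    exact aux_phi_bdd hM n le_rfl x hx
  · have hm := aux_mu_pos hM.1 n
    have h1 : Real.log (mu M n) * n - omegaM M (Real.exp (Real.log (mu M n))) ≤ phiStar M n :=
      le_csSup (aux_phi_bddAbove hM n)
        ⟨Real.log (mu M n), Real.log_nonneg (aux_mu_ge_one hM n hn), rfl⟩
    rw [Real.exp_log hm] at h1
    have := aux_om_mu hM n hn
    linarith

theorem aux_phi_mono {M : ℕ → ℝ} (hM : IsLC M) {y z : ℝ} (hy : 0 < y) (hz : y ≤ z) :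
    phiStar M y / y ≤ phiStar M z / z := by
  have hz0 := hy.trans_le hz
  rw [div_le_iff₀ hy]
  apply csSup_le (Set.Nonempty.image _ Set.nonempty_Ici)
  rintro _ ⟨x, hx, rfl⟩
  have h1 : x * z - omegaM M (Real.exp x) ≤ phiStar M z :=
    le_csSup (aux_phi_bddAbove hM z) ⟨x, hx, rfl⟩
  have h2 := aux_om_nonneg hM (Real.exp_pos x)
  have h3 : y / z ≤ 1 := (div_le_one hz0).2 hz
  have h4 : 0 < y / z := by positivity
  calc x * y - omegaM M (Real.exp x) ≤ x * y - (y / z) * omegaM M (Real.exp x) := by nlinarith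
    _ = (y / z) * (x * z - omegaM M (Real.exp x)) := by field_simp
    _ ≤ (y / z) * phiStar M z := by gcongr
    _ = _ := by ring

theorem aux_mMat_root (M : ℕ → ℝ) (l : ℝ) (hl : 0 < l) (p : ℕ) :
    mMat M l p ^ (1 / (p:ℝ)) =
      Real.exp (phiStar M (l * p) / (l * p)) / (p.factorial : ℝ) ^ (1 / (p:ℝ)) := by
  unfold mMat MMat
  rw [Real.div_rpow (Real.exp_pos _).le (by positivity), ← Real.exp_mul]
  congr 2
  field_simp

theorem aux_exp_phi {M : ℕ → ℝ} (hM : IsLC M) (n : ℕ) (hn : 1 ≤ n) :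
    Real.exp (phiStar M n / n) = M n ^ (1 / (n:ℝ)) := by
  rw [aux_phi_nat hM n hn, Real.rpow_def_of_pos (hM.1 n), mul_one_div]

theorem aux_vii_of_R {M : ℕ → ℝ} (hM : IsLC M) (h : AuxR M) : MRai M := by
  obtain ⟨A, hA, h⟩ := h
  intro x hx
  set n : ℕ := ⌈x⌉₊ with hn
  have hn1 : 1 ≤ n := Nat.ceil_pos.2 hx
  have hxn : x ≤ n := Nat.le_ceil x
  have hn' : (0:ℝ) < n := by exact_mod_cast hn1
  refine ⟨A * Real.exp 1, by positivity, n, hn', ?_⟩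
  intro p q hp hq
  have hp' : (0:ℝ) < p := by exact_mod_cast hp
  have hq1 := hp.trans hq
  rw [aux_mMat_root M x hx, aux_mMat_root M n hn']
  have e := aux_exp_phi hM (n * q) (Nat.mul_pos hn1 hq1)
  have e' := aux_exp_phi hM (n * p) (Nat.mul_pos hn1 hp)
  have h1 := h (n * p) (n * q) (Nat.mul_pos hn1 hp) (Nat.mul_le_mul_left n hq)
  rw [← e, ← e'] at h1
  push_cast at h1
  have h2 : phiStar M (x * p) / (x * p) ≤ phiStar M (n * p) / (n * p) :=
    aux_phi_mono hM (by positivity) (by gcongr)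
  have h2 := Real.exp_le_exp.2 h2
  have fp := aux_le_fact p hp
  have fq := aux_fact_le q hq1
  have h3 : Real.exp (phiStar M (n * p) / (n * p)) * q ≤
      A * (Real.exp (phiStar M (n * q) / (n * q)) * p) := by
    apply le_of_mul_le_mul_left _ hn'
    linarith
  rw [mul_div_assoc', div_le_div_iff₀ (by positivity) (by positivity)]
  calc _ ≤ Real.exp (phiStar M (n * p) / (n * p)) * q := by gcongr
    _ ≤ _ := h3
    _ ≤ A * (Real.exp (phiStar M (n * q) / (n * q)) *
        (Real.exp 1 * ((p.factorial : ℝ)) ^ (1 / (p:ℝ)))) := by gcongr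
    _ = _ := by ring

theorem aux_R_of_vii {M : ℕ → ℝ} (hM : IsLC M) (hmg : HasMG M) (h : MRai M) : AuxR M := by
  obtain ⟨K, hK, hmg⟩ := hmg
  obtain ⟨C, hC, y, hy, h⟩ := h 1 one_pos
  have hpos := hM.1
  have hdbl : ∀ k q : ℕ, 1 ≤ q →
      M (2 ^ k * q) ^ (1 / ((2 ^ k * q : ℕ):ℝ)) ≤ K ^ k * M q ^ (1 / (q:ℝ)) := by
    intro k q hq
    induction k with
    | zero => simp
    | succ k ih =>
      have h1 := aux_mg2 hpos hK hmg (2 ^ k * q) (Nat.mul_pos (by positivity) hq)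
      rw [← mul_assoc, ← pow_succ'] at h1
      refine h1.trans ?_
      calc _ ≤ K * (K ^ k * M q ^ (1 / (q:ℝ))) := by gcongr
        _ = _ := by ring
  obtain ⟨k, hk⟩ := pow_unbounded_of_one_lt y (one_lt_two (α := ℝ))
  apply aux_R_of_iii hpos
  refine ⟨max 1 (C * K ^ k), le_max_left _ _, ?_⟩
  intro p q hp hq
  have hq1 := hp.trans hq
  have hq' : (0:ℝ) < q := by exact_mod_cast hq1
  have h1 := h p q hp hq
  rw [aux_mMat_root M 1 one_pos, aux_mMat_root M y hy, one_mul, aux_exp_phi hM p hp] at h1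
  have h2 : phiStar M (y * q) / (y * q) ≤
      phiStar M ((2 ^ k * q : ℕ):ℝ) / ((2 ^ k * q : ℕ):ℝ) :=
    aux_phi_mono hM (by positivity) (by push_cast; gcongr)
  have h2 := Real.exp_le_exp.2 h2
  rw [aux_exp_phi hM (2 ^ k * q) (Nat.mul_pos (by positivity) hq1)] at h2
  have h3 := h2.trans (hdbl k q hq1)
  rw [aux_mseq_root hpos, aux_mseq_root hpos]
  have rq : 0 < M q ^ (1 / (q:ℝ)) := Real.rpow_pos_of_pos (hpos q) _
  calc _ ≤ _ := h1
    _ ≤ C * (K ^ k * M q ^ (1 / (q:ℝ)) / (q.factorial : ℝ) ^ (1 / (q:ℝ))) := by gcongr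
    _ = (C * K ^ k) * (M q ^ (1 / (q:ℝ)) / (q.factorial : ℝ) ^ (1 / (q:ℝ))) := by ring
    _ ≤ _ := mul_le_mul_of_nonneg_right (le_max_right _ _) (by positivity)

/-- Theorem 4.7: characterization of `(α0)` for `ω_M` under moderate growth. -/
theorem stmt15 (M : ℕ → ℝ) (hM : IsLC M) (hmg : HasMG M) :
    List.TFAE [
      ∃ B : ℝ, 1 ≤ B ∧ ∀ lam p : ℕ, 1 ≤ lam → 1 ≤ p →
        (lam : ℝ) * (M p) ^ (1 / (p : ℝ)) ≤
          B * (M (lam * p)) ^ (1 / ((lam : ℝ) * p)),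
      ∃ B : ℝ, 1 ≤ B ∧ ∀ lam p : ℕ, 1 ≤ lam → 1 ≤ p →
        (lam : ℝ) * mu M p ≤ B * mu M (lam * p),
      ∃ A : ℝ, 1 ≤ A ∧ ∀ p q : ℕ, 1 ≤ p → p ≤ q →
        (mseq M p) ^ (1 / (p : ℝ)) ≤ A * (mseq M q) ^ (1 / (q : ℝ)),
      ∃ A : ℝ, 1 ≤ A ∧ ∀ p q : ℕ, 1 ≤ p → p ≤ q →
        mu M p / p ≤ A * (mu M q / q),
      ∃ S : ℕ → ℝ, IsLC S ∧ Approx M S ∧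
        (∀ p : ℕ, 1 ≤ p → (mseq S p) ^ 2 ≤ mseq S (p - 1) * mseq S (p + 1)),
      Alpha0 (omegaM M),
      MRai M] := by
  tfae_have 1 → 3 := fun h => aux_iii_of_R hM.1 (aux_R_of_i hM h)
  tfae_have 3 → 1 := fun h => aux_i_of_R (aux_R_of_iii hM.1 h)
  tfae_have 2 → 4 := fun h => aux_iv_of_ii hM h
  tfae_have 4 → 2 := fun h => aux_ii_of_iv h
  tfae_have 3 → 4 := fun h => aux_iv_of_R hM hmg (aux_R_of_iii hM.1 h)
  tfae_have 4 → 5 := fun h => aux_v_of_iv hM h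
  tfae_have 5 → 3 := fun h => aux_iii_of_R hM.1 (aux_R_of_v hM h)
  tfae_have 3 → 6 := fun h => aux_vi_of_R hM (aux_R_of_iii hM.1 h)
  tfae_have 6 → 1 := fun h => aux_i_of_vi hM hmg h
  tfae_have 3 → 7 := fun h => aux_vii_of_R hM (aux_R_of_iii hM.1 h)
  tfae_have 7 → 3 := fun h => aux_iii_of_R hM.1 (aux_R_of_vii hM hmg h)
  tfae_finish
end
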